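/- Let ‖·‖ be a norm on ℝ^d with dual norm ‖·‖_*, let c(z, ẑ) = ‖z − ẑ‖², and define ℓ_c(θ, λ, ẑ) = sup_{z ∈ ℝ^d} L(⟨θ, z⟩) − λ ‖z − ẑ‖². Suppose L : ℝ → ℝ is convex, upper semicontinuous, differentiable and M-smooth (|L'(s₁) − L'(s₂)| ≤ M |s₁ − s₂| for all s₁, s₂) with quadratic growth rate G = inf{g ≥ 0 : sup_s L(s) − gs² < ∞}, fix θ ∈ ℝ^d, suppose ẑ ↦ L(⟨θ, ẑ⟩) is P̂-integrable and E := ∫ |L'(⟨θ, ẑ⟩)|² dP̂(ẑ) < ∞, and let ε > 0. Then the problem inf_{λ ≥ 0} ( λ ε + ∫ ℓ_c(θ, λ, ẑ) dP̂(ẑ) ) admits a minimizer λ* satisfying ( E ‖θ‖_*² / (4ε) )^{1/2} ≤ λ* ≤ ( E ‖θ‖_*² / ε )^{1/2} + M ‖θ‖_*² / 2. -/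

import Mathlib

open MeasureTheory Set

noncomputable section

/-- The inner product `⟨x, y⟩ = Σ_i x_i y_i` on `ℝ^d`. -/
def dotp {d : ℕ} (x y : Fin d → ℝ) : ℝ := ∑ i, x i * y i

/-- The dual norm `‖θ‖_* = sup {⟨θ, x⟩ : ‖x‖ ≤ 1}` of a norm `N` on `ℝ^d`. -/
def dualNorm {d : ℕ} (N : (Fin d → ℝ) → ℝ) (θ : Fin d → ℝ) : ℝ :=
  sSup {r : ℝ | ∃ x : Fin d → ℝ, N x ≤ 1 ∧ r = dotp θ x}

/-- The `[0,∞]`-valued positive part of an extended real number. -/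
def erealPos (x : EReal) : ENNReal := if x = ⊤ then ⊤ else ENNReal.ofReal x.toReal

/-- The `(−∞,∞]`-valued integral of a `(−∞,∞]`-valued function. -/
def eint {α : Type*} [MeasurableSpace α] (μ : MeasureTheory.Measure α) (f : α → EReal) :
    EReal :=
  ((∫⁻ a, erealPos (f a) ∂μ : ENNReal) : EReal) -
    ((∫⁻ a, erealPos (-(f a)) ∂μ : ENNReal) : EReal)

/-- The `c`-transform `ℓ_c(θ, λ, ẑ) = sup_z L(⟨θ, z⟩) − λ‖z − ẑ‖²` for the quadratic
transportation cost induced by the norm `N`. -/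
def cTransform2 {d : ℕ} (N : (Fin d → ℝ) → ℝ) (L : ℝ → ℝ) (θ : Fin d → ℝ) (lam : ℝ)
    (zhat : Fin d → ℝ) : EReal :=
  ⨆ z : Fin d → ℝ, ((L (dotp θ z) : ℝ) : EReal) - ((lam * N (z - zhat) ^ 2 : ℝ) : EReal)

theorem exists_abs_le_mul_of_norm {V : Type*} [AddCommGroup V] [Module ℝ V]
    [FiniteDimensional ℝ V] (N : V → ℝ)
    (hN0 : ∀ x, N x = 0 ↔ x = 0)
    (hNhom : ∀ (a : ℝ) x, N (a • x) = |a| * N x)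
    (hNtri : ∀ x y, N (x + y) ≤ N x + N y) (f : V →ₗ[ℝ] ℝ) :
    ∃ C, ∀ x, |f x| ≤ C * N x := by
  let G : AddGroupNorm V :=
    { toFun := N
      map_zero' := (hN0 0).2 rfl
      add_le' := hNtri
      neg' := fun x => by simpa using hNhom (-1) x
      eq_zero_of_map_eq_zero' := fun x hx => (hN0 x).1 hx }
  let _ : NormedAddCommGroup V := G.toNormedAddCommGroup
  let _ : NormedSpace ℝ V := ⟨fun a x => (hNhom a x).le⟩
  exact ⟨‖f.toContinuousLinearMap‖, fun x => f.toContinuousLinearMap.le_opNorm x⟩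

theorem ConvexOn.add_mul_sub_le_of_hasDerivAt {f : ℝ → ℝ} {f' x : ℝ}
    (hf : ConvexOn ℝ Set.univ f) (hx : HasDerivAt f f' x) (y : ℝ) :
    f x + f' * (y - x) ≤ f y := by
  rcases lt_trichotomy x y with h | rfl | h
  · have := hf.le_slope_of_hasDerivAt (mem_univ x) (mem_univ y) h hx
    rw [slope_def_field, le_div_iff₀ (sub_pos.2 h)] at this
    linarith
  · simp
  · have := hf.slope_le_of_hasDerivAt (mem_univ y) (mem_univ x) h hx
    rw [slope_def_field, div_le_iff₀ (sub_pos.2 h)] at this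
    linarith

theorem le_add_mul_add_sq_of_lipschitz_deriv {L L' : ℝ → ℝ}
    (hL : ∀ s, HasDerivAt L (L' s) s) {M : ℝ}
    (hM : ∀ s t : ℝ, |L' s - L' t| ≤ M * |s - t|) (s t : ℝ) :
    L (s + t) ≤ L s + L' s * t + M / 2 * t ^ 2 := by
  have hd : ∀ x, HasDerivAt (fun x => M / 2 * x ^ 2 - L x) (M * x - L' x) x := fun x =>
    (((hasDerivAt_pow 2 x).const_mul (M / 2)).sub (hL x)).congr_deriv (by push_cast; ring)
  have hmono : Monotone (deriv fun x => M / 2 * x ^ 2 - L x) := by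
    intro x y hxy
    rw [(hd x).deriv, (hd y).deriv]
    have := (le_abs_self _).trans (hM y x)
    rw [abs_of_nonneg (sub_nonneg.2 hxy)] at this
    linarith
  have := (hmono.convexOn_univ_of_deriv fun x =>
    (hd x).differentiableAt).add_mul_sub_le_of_hasDerivAt (hd s) (s + t)
  linear_combination this

theorem ConvexOn.mul_sub_le_of_one_le {L : ℝ → ℝ} (hL : ConvexOn ℝ Set.univ L) {r : ℝ}
    (hr : 1 ≤ r) (s t : ℝ) : r * (L (s + t) - L s) ≤ L (s + r * t) - L s := by
  have hr0 : 0 < r := by linarith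
  have h := hL.2 (mem_univ s) (mem_univ (s + r * t))
    (sub_nonneg.2 (inv_le_one_of_one_le₀ hr)) (inv_nonneg.2 hr0.le) (sub_add_cancel 1 r⁻¹)
  simp only [smul_eq_mul] at h
  have e : (1 - r⁻¹) * s + r⁻¹ * (s + r * t) = s + t := by field_simp; ring
  rw [e] at h
  have h2 := mul_le_mul_of_nonneg_left h hr0.le
  have e2 : r * ((1 - r⁻¹) * L s + r⁻¹ * L (s + r * t)) = (r - 1) * L s + L (s + r * t) := by
    field_simp
  rw [e2] at h2
  linarith

theorem dotp_add {d : ℕ} (θ x y : Fin d → ℝ) : dotp θ (x + y) = dotp θ x + dotp θ y := by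
  simp [dotp, mul_add, Finset.sum_add_distrib]

theorem dotp_smul {d : ℕ} (θ : Fin d → ℝ) (a : ℝ) (x : Fin d → ℝ) :
    dotp θ (a • x) = a * dotp θ x := by
  simp only [dotp, Pi.smul_apply, smul_eq_mul, Finset.mul_sum]
  exact Finset.sum_congr rfl fun i _ => by ring

theorem dotp_zero {d : ℕ} (θ : Fin d → ℝ) : dotp θ 0 = 0 := by simp [dotp]

theorem continuous_dotp {d : ℕ} (θ : Fin d → ℝ) : Continuous (dotp θ) := by
  unfold dotp
  fun_prop

/-- A function `N` that satisfies the axioms of a norm on `ℝ^d`. -/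
structure IsNormFun {d : ℕ} (N : (Fin d → ℝ) → ℝ) : Prop where
  eq_zero_iff : ∀ x, N x = 0 ↔ x = 0
  smul : ∀ (a : ℝ) x, N (a • x) = |a| * N x
  add_le : ∀ x y, N (x + y) ≤ N x + N y

namespace IsNormFun

variable {d : ℕ} {N : (Fin d → ℝ) → ℝ}

theorem map_zero (hN : IsNormFun N) : N 0 = 0 := (hN.eq_zero_iff 0).2 rfl

theorem nonneg (hN : IsNormFun N) (x : Fin d → ℝ) : 0 ≤ N x := by
  have h := hN.add_le x ((-1 : ℝ) • x)
  rw [hN.smul] at h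
  simp [hN.map_zero] at h
  linarith

theorem bddAbove_dualNorm (hN : IsNormFun N) (θ : Fin d → ℝ) :
    BddAbove {r : ℝ | ∃ x : Fin d → ℝ, N x ≤ 1 ∧ r = dotp θ x} := by
  let f : (Fin d → ℝ) →ₗ[ℝ] ℝ :=
    { toFun := dotp θ
      map_add' := dotp_add θ
      map_smul' := dotp_smul θ }
  obtain ⟨C, hC⟩ := exists_abs_le_mul_of_norm N hN.eq_zero_iff hN.smul hN.add_le f
  refine ⟨|C|, ?_⟩
  rintro r ⟨x, hx, rfl⟩
  calc dotp θ x ≤ |f x| := le_abs_self _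
    _ ≤ C * N x := hC x
    _ ≤ |C| * 1 := mul_le_mul (le_abs_self C) hx (hN.nonneg x) (abs_nonneg C)
    _ = |C| := mul_one _

theorem dotp_le_dualNorm (hN : IsNormFun N) (θ : Fin d → ℝ) {x : Fin d → ℝ} (hx : N x ≤ 1) :
    dotp θ x ≤ dualNorm N θ :=
  le_csSup (hN.bddAbove_dualNorm θ) ⟨x, hx, rfl⟩

theorem dualNorm_nonneg (hN : IsNormFun N) (θ : Fin d → ℝ) : 0 ≤ dualNorm N θ := by
  have := hN.dotp_le_dualNorm θ (x := 0) (by simp [hN.map_zero])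
  rwa [dotp_zero] at this

theorem dualNorm_le (hN : IsNormFun N) (θ : Fin d → ℝ) {c : ℝ}
    (h : ∀ x, N x ≤ 1 → dotp θ x ≤ c) : dualNorm N θ ≤ c := by
  refine csSup_le ⟨dotp θ 0, 0, by simp [hN.map_zero], rfl⟩ ?_
  rintro r ⟨x, hx, rfl⟩
  exact h x hx

theorem abs_dotp_le (hN : IsNormFun N) (θ x : Fin d → ℝ) :
    |dotp θ x| ≤ dualNorm N θ * N x := by
  have key : ∀ y, dotp θ y ≤ dualNorm N θ * N y := by
    intro y
    rcases eq_or_ne y 0 with rfl | hy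
    · simp [dotp_zero, hN.map_zero]
    · have hp : 0 < N y := lt_of_le_of_ne (hN.nonneg y) fun h => hy ((hN.eq_zero_iff y).1 h.symm)
      have := hN.dotp_le_dualNorm θ (x := (N y)⁻¹ • y) (by
        rw [hN.smul, abs_of_nonneg (by positivity), inv_mul_cancel₀ hp.ne'])
      rwa [dotp_smul, inv_mul_le_iff₀ hp, mul_comm] at this
  refine abs_le'.2 ⟨key x, ?_⟩
  have := key ((-1 : ℝ) • x)
  rw [dotp_smul, hN.smul] at this
  simpa using this

end IsNormFun

/-- The gain `sup_w L(s + ⟨θ, w⟩) − L(s) − λ‖w‖²` of the adversary over not moving. -/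
def gain {d : ℕ} (N : (Fin d → ℝ) → ℝ) (L : ℝ → ℝ) (θ : Fin d → ℝ) (lam s : ℝ) : ENNReal :=
  ⨆ w : Fin d → ℝ, ENNReal.ofReal (L (s + dotp θ w) - L s - lam * N w ^ 2)

section Gain

variable {d : ℕ} {N : (Fin d → ℝ) → ℝ} {L : ℝ → ℝ} {θ : Fin d → ℝ}

theorem measurable_gain (hL : Continuous L) (lam : ℝ) : Measurable (gain N L θ lam) := by
  refine (lowerSemicontinuous_iSup fun w => Continuous.lowerSemicontinuous ?_).measurable
  exact ENNReal.continuous_ofReal.comp (by fun_prop)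

theorem measurable_gain_dotp (hL : Continuous L) (lam : ℝ) :
    Measurable fun z => gain N L θ lam (dotp θ z) :=
  (measurable_gain hL lam).comp (continuous_dotp θ).measurable

theorem antitone_gain (s : ℝ) : Antitone fun lam => gain N L θ lam s := by
  intro a b hab
  refine iSup_mono fun w => ENNReal.ofReal_le_ofReal ?_
  have := mul_le_mul_of_nonneg_right hab (sq_nonneg (N w))
  linarith

theorem iSup_gain_add_inv (lam s : ℝ) :
    ⨆ n : ℕ, gain N L θ (lam + 1 / ((n : ℝ) + 1)) s = gain N L θ lam s := by
  unfold gain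
  rw [iSup_comm]
  refine iSup_congr fun w => ?_
  refine iSup_eq_of_tendsto (fun m n hmn => ?_) ?_
  · refine ENNReal.ofReal_le_ofReal ?_
    have := mul_le_mul_of_nonneg_right (Nat.one_div_le_one_div (α := ℝ) hmn) (sq_nonneg (N w))
    linarith
  · refine ENNReal.tendsto_ofReal ?_
    have := (tendsto_one_div_add_atTop_nhds_zero_nat (𝕜 := ℝ)).const_add lam
    rw [add_zero] at this
    exact tendsto_const_nhds.sub (this.mul_const _)

theorem mul_gain_mul_le (hN : IsNormFun N) (hL : ConvexOn ℝ Set.univ L) {r : ℝ} (hr : 1 ≤ r)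
    (lam s : ℝ) : ENNReal.ofReal r * gain N L θ (r * lam) s ≤ gain N L θ lam s := by
  unfold gain
  rw [ENNReal.mul_iSup]
  refine iSup_le fun w => le_iSup_of_le (r • w) ?_
  rw [← ENNReal.ofReal_mul (by linarith)]
  refine ENNReal.ofReal_le_ofReal ?_
  have := hL.mul_sub_le_of_one_le hr s (dotp θ w)
  rw [dotp_smul, hN.smul, mul_pow, sq_abs]
  linarith

theorem gain_le (hN : IsNormFun N) {L' : ℝ → ℝ} (hL : ∀ s, HasDerivAt L (L' s) s) {M : ℝ}
    (hM : ∀ s t : ℝ, |L' s - L' t| ≤ M * |s - t|) {c s q : ℝ}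
    (hq : ∀ n : ℝ, |L' s * dualNorm N θ| * n - c * n ^ 2 ≤ q) :
    gain N L θ (M * dualNorm N θ ^ 2 / 2 + c) s ≤ ENNReal.ofReal q := by
  refine iSup_le fun w => ENNReal.ofReal_le_ofReal (le_trans ?_ (hq (N w)))
  have hM0 : 0 ≤ M := by simpa using (abs_nonneg _).trans (hM 1 0)
  have h1 := le_add_mul_add_sq_of_lipschitz_deriv hL hM s (dotp θ w)
  have h2 := hN.abs_dotp_le θ w
  have h3 : L' s * dotp θ w ≤ |L' s * dualNorm N θ| * N w := by
    rw [abs_mul, abs_of_nonneg (hN.dualNorm_nonneg θ), mul_assoc]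
    refine (le_abs_self _).trans ?_
    rw [abs_mul]
    exact mul_le_mul_of_nonneg_left h2 (abs_nonneg _)
  have h4 : dotp θ w ^ 2 ≤ dualNorm N θ ^ 2 * N w ^ 2 := by
    rw [← mul_pow, ← sq_abs (dotp θ w)]
    exact pow_le_pow_left₀ (abs_nonneg _) h2 2
  have h5 := mul_le_mul_of_nonneg_left h4 (div_nonneg hM0 zero_le_two)
  linarith

theorem le_gain (hN : IsNormFun N) (hL : ConvexOn ℝ Set.univ L) {s l lam : ℝ}
    (hl : HasDerivAt L l s) (hlam : 0 < lam) {x : Fin d → ℝ} (hx : N x ≤ 1) :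
    ENNReal.ofReal (dotp θ x ^ 2 / (4 * lam) * l ^ 2) ≤ gain N L θ lam s := by
  refine le_iSup_of_le ((l * dotp θ x / (2 * lam)) • x) (ENNReal.ofReal_le_ofReal ?_)
  rw [dotp_smul, hN.smul, mul_pow, sq_abs]
  have h1 := hL.add_mul_sub_le_of_hasDerivAt hl (s + l * dotp θ x / (2 * lam) * dotp θ x)
  have h2 : N x ^ 2 ≤ 1 := pow_le_one₀ (hN.nonneg x) hx
  have h3 := mul_le_mul_of_nonneg_left h2
    (show 0 ≤ lam * (l * dotp θ x / (2 * lam)) ^ 2 by positivity)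
  have h4 : lam * (l * dotp θ x / (2 * lam)) ^ 2 = dotp θ x ^ 2 / (4 * lam) * l ^ 2 := by
    field_simp; ring
  have h5 : l * (s + l * dotp θ x / (2 * lam) * dotp θ x - s)
      = 2 * (dotp θ x ^ 2 / (4 * lam) * l ^ 2) := by
    field_simp; ring
  linarith

theorem cTransform2_eq (hN : IsNormFun N) (lam : ℝ) (z : Fin d → ℝ) :
    cTransform2 N L θ lam z
      = ((L (dotp θ z) : ℝ) : EReal) + ((gain N L θ lam (dotp θ z) : ENNReal) : EReal) := by
  refine le_antisymm (iSup_le fun y => ?_) ?_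
  · have h : ((L (dotp θ y) - L (dotp θ z) - lam * N (y - z) ^ 2 : ℝ) : EReal)
        ≤ ((gain N L θ lam (dotp θ z) : ENNReal) : EReal) := by
      have h1 : ENNReal.ofReal (L (dotp θ y) - L (dotp θ z) - lam * N (y - z) ^ 2)
          ≤ gain N L θ lam (dotp θ z) :=
        le_iSup_of_le (y - z) (by rw [← dotp_add, add_sub_cancel])
      refine le_trans ?_ (EReal.coe_ennreal_le_coe_ennreal_iff.2 h1)
      rw [EReal.coe_ennreal_ofReal]
      exact EReal.coe_le_coe_iff.2 (le_max_left _ _)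
    refine le_trans (le_of_eq ?_) (add_le_add_right h _)
    norm_cast
    ring
  · rw [add_comm]
    refine EReal.add_le_of_le_sub ?_
    have hle : ∀ w, ((L (dotp θ z + dotp θ w) - L (dotp θ z) - lam * N w ^ 2 : ℝ) : EReal)
        ≤ cTransform2 N L θ lam z - ((L (dotp θ z) : ℝ) : EReal) := fun w => by
      rw [EReal.le_sub_iff_add_le (by simp) (by simp)]
      refine le_trans (le_of_eq ?_) (le_iSup _ (z + w))
      rw [add_sub_cancel_left, dotp_add]
      norm_cast
      ring
    have h0 := hle 0
    rw [dotp_zero, hN.map_zero] at h0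
    rw [← EReal.coe_toENNReal (x := cTransform2 N L θ lam z - _) (by simpa using h0),
      EReal.coe_ennreal_le_coe_ennreal_iff]
    exact iSup_le fun w => EReal.toENNReal_le_toENNReal (hle w)

end Gain

theorem erealPos_add_ofReal_neg (x : ℝ) (g : ENNReal) :
    ENNReal.ofReal (-x) + erealPos ((x : EReal) + (g : EReal))
      = erealPos (-((x : EReal) + (g : EReal))) + (ENNReal.ofReal x + g) := by
  induction g using ENNReal.recTopCoe with
  | top => simp [erealPos]
  | coe g =>
    have e : (x : EReal) + (((g : NNReal) : ENNReal) : EReal) = ((x + g : ℝ) : EReal) := by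
      push_cast; rfl
    rw [e, ← EReal.coe_neg]
    simp only [erealPos, EReal.coe_ne_top, if_false, EReal.toReal_coe]
    rw [← ENNReal.ofReal_coe_nnreal (p := g), ← ENNReal.toReal_eq_toReal_iff' (by finiteness)
      (by finiteness), ENNReal.toReal_add (by finiteness) (by finiteness),
      ENNReal.toReal_add (by finiteness) (by finiteness),
      ENNReal.toReal_add (by finiteness) (by finiteness)]
    simp only [ENNReal.toReal_ofReal', max_def]
    split_ifs <;> linarith [g.2]

theorem erealPos_neg_le (x : ℝ) (g : ENNReal) :
    erealPos (-((x : EReal) + (g : EReal))) ≤ ENNReal.ofReal (-x) := by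
  induction g using ENNReal.recTopCoe with
  | top => simp [erealPos]
  | coe g =>
    have e : (x : EReal) + (((g : NNReal) : ENNReal) : EReal) = ((x + g : ℝ) : EReal) := by
      push_cast; rfl
    rw [e, ← EReal.coe_neg]
    simp only [erealPos, EReal.coe_ne_top, if_false, EReal.toReal_coe]
    exact ENNReal.ofReal_le_ofReal (by linarith [g.2])

theorem eint_add_coe {α : Type*} [MeasurableSpace α] {μ : Measure α} {f : α → ℝ}
    (hf : Integrable f μ) (hfm : Measurable f) {g : α → ENNReal} (hg : Measurable g) :
    eint μ (fun a => (f a : EReal) + (g a : EReal))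
      = ((∫ a, f a ∂μ : ℝ) : EReal) + ((∫⁻ a, g a ∂μ : ENNReal) : EReal) := by
  have hsum := lintegral_congr (μ := μ) fun a => erealPos_add_ofReal_neg (f a) (g a)
  rw [lintegral_add_left (f := fun a => ENNReal.ofReal (-f a)) hfm.neg.ennreal_ofReal, lintegral_add_right
    (g := fun a => ENNReal.ofReal (f a) + g a) _ (hfm.ennreal_ofReal.add hg),
    lintegral_add_left hfm.ennreal_ofReal] at hsum
  have hle := lintegral_mono (μ := μ) fun a => erealPos_neg_le (f a) (g a)
  have hpos : ∫⁻ a, ENNReal.ofReal (f a) ∂μ ≠ ⊤ := hf.lintegral_lt_top.ne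
  have hneg : ∫⁻ a, ENNReal.ofReal (-f a) ∂μ ≠ ⊤ := hf.neg.lintegral_lt_top.ne
  have hn := ne_top_of_le_ne_top hneg hle
  rw [eint, integral_eq_lintegral_pos_part_sub_lintegral_neg_part hf]
  generalize ∫⁻ a, ENNReal.ofReal (f a) ∂μ = a at *
  generalize ∫⁻ a, ENNReal.ofReal (-f a) ∂μ = b at *
  generalize ∫⁻ a, g a ∂μ = G at *
  generalize ∫⁻ a, erealPos (-((f a : EReal) + (g a : EReal))) ∂μ = n at *
  generalize ∫⁻ a, erealPos ((f a : EReal) + (g a : EReal)) ∂μ = p at *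
  lift a to NNReal using hpos
  lift b to NNReal using hneg
  lift n to NNReal using hn
  induction G using ENNReal.recTopCoe with
  | top =>
    have : p = ⊤ := by simpa using hsum
    subst this
    rw [EReal.coe_ennreal_top, EReal.coe_add_top]
    exact EReal.top_sub_coe n
  | coe G =>
    have hp : p ≠ ⊤ := fun h => by
      rw [h, add_top] at hsum
      exact absurd hsum.symm (by finiteness)
    lift p to NNReal using hp
    have : (b : ℝ) + p = n + (a + G) := by exact_mod_cast hsum
    have e : (p : ℝ) - n = (a - b) + G := by linarith
    rw [ENNReal.coe_toReal, ENNReal.coe_toReal]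
    have e' := congrArg Real.toEReal e
    rw [EReal.coe_sub, EReal.coe_add] at e'
    exact e'

section DualGain

variable {d : ℕ} {N : (Fin d → ℝ) → ℝ} {L L' : ℝ → ℝ} {θ : Fin d → ℝ}
  {μ : Measure (Fin d → ℝ)}

variable (N L θ μ) in
/-- The expected gain of the adversary, as a function of the multiplier `λ`. -/
def dualGain (lam : ℝ) : ENNReal := ∫⁻ z, gain N L θ lam (dotp θ z) ∂μ

theorem antitone_dualGain : Antitone (dualGain N L θ μ) := fun _ _ h =>
  lintegral_mono fun z => antitone_gain (dotp θ z) h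

theorem lowerSemicontinuous_dualGain (hL : Continuous L) :
    LowerSemicontinuous (dualGain N L θ μ) := by
  intro lam y hy
  have hsup : dualGain N L θ μ lam = ⨆ n : ℕ, dualGain N L θ μ (lam + 1 / ((n : ℝ) + 1)) := by
    unfold dualGain
    rw [← lintegral_iSup
      (fun n => measurable_gain_dotp hL _)
      (fun m n hmn z => antitone_gain _
        (add_le_add_right (Nat.one_div_le_one_div (α := ℝ) hmn) lam))]
    exact lintegral_congr fun z => (iSup_gain_add_inv lam _).symm
  obtain ⟨n, hn⟩ := lt_iSup_iff.1 (hsup ▸ hy : y < _)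
  filter_upwards [Iio_mem_nhds (show lam < lam + 1 / ((n : ℝ) + 1) by
    have : 0 < 1 / ((n : ℝ) + 1) := by positivity
    linarith)] with x hx
  exact hn.trans_le (antitone_dualGain (le_of_lt hx))

theorem mul_dualGain_mul_le (hN : IsNormFun N) (hL : ConvexOn ℝ Set.univ L) {r : ℝ}
    (hr : 1 ≤ r) (lam : ℝ) :
    ENNReal.ofReal r * dualGain N L θ μ (r * lam) ≤ dualGain N L θ μ lam := by
  unfold dualGain
  rw [← lintegral_const_mul' _ _ ENNReal.ofReal_ne_top]
  exact lintegral_mono fun z => mul_gain_mul_le hN hL hr lam _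

theorem le_dualGain (hN : IsNormFun N) (hL : ConvexOn ℝ Set.univ L)
    (hLd : ∀ s, HasDerivAt L (L' s) s)
    (hint' : Integrable (fun z => (L' (dotp θ z)) ^ 2) μ) {lam : ℝ} (hlam : 0 < lam)
    {x : Fin d → ℝ} (hx : N x ≤ 1) :
    ENNReal.ofReal (dotp θ x ^ 2 / (4 * lam) * ∫ z, (L' (dotp θ z)) ^ 2 ∂μ)
      ≤ dualGain N L θ μ lam := by
  rw [← integral_const_mul, ofReal_integral_eq_lintegral_ofReal (hint'.const_mul _)
    (Filter.Eventually.of_forall fun z => by positivity)]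
  exact lintegral_mono fun z => le_gain hN hL (hLd _) hlam hx

theorem dualGain_le (hN : IsNormFun N) (hLd : ∀ s, HasDerivAt L (L' s) s) {M : ℝ}
    (hM : ∀ s t : ℝ, |L' s - L' t| ≤ M * |s - t|)
    (hint' : Integrable (fun z => (L' (dotp θ z)) ^ 2) μ) {c ε : ℝ} (hc : 0 ≤ c)
    (h : (∫ z, (L' (dotp θ z)) ^ 2 ∂μ) * dualNorm N θ ^ 2 = 4 * ε * c ^ 2) :
    dualGain N L θ μ (M * dualNorm N θ ^ 2 / 2 + c) ≤ ENNReal.ofReal (ε * c) := by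
  have hi : Integrable (fun z => (L' (dotp θ z) * dualNorm N θ) ^ 2) μ := by
    simpa only [mul_pow] using hint'.mul_const (dualNorm N θ ^ 2)
  have hI : ∫ z, (L' (dotp θ z) * dualNorm N θ) ^ 2 ∂μ = 4 * ε * c ^ 2 := by
    simp only [mul_pow, integral_mul_const, h]
  rcases hc.eq_or_lt with rfl | hc
  · have h0 : (fun z => (L' (dotp θ z) * dualNorm N θ) ^ 2) =ᵐ[μ] 0 :=
      (integral_eq_zero_iff_of_nonneg (fun z => sq_nonneg _) hi).1 (by simpa using hI)
    refine le_of_eq_of_le (lintegral_eq_zero_of_ae_eq_zero ?_) zero_le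
    filter_upwards [h0] with z hz
    have hz' : L' (dotp θ z) * dualNorm N θ = 0 := by simpa using hz
    have := gain_le (θ := θ) hN hLd hM (c := 0) (s := dotp θ z) (q := 0)
      (fun n => by rw [hz']; simp)
    simpa using this
  · have e : ε * c = ∫ z, (4 * c)⁻¹ * (L' (dotp θ z) * dualNorm N θ) ^ 2 ∂μ := by
      rw [integral_const_mul, hI]
      field_simp
    rw [e, ofReal_integral_eq_lintegral_ofReal (hi.const_mul _)
      (Filter.Eventually.of_forall fun z => by positivity)]
    refine lintegral_mono fun z => gain_le hN hLd hM fun n => ?_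
    rw [← sq_abs (L' _ * _), inv_mul_eq_div, le_div_iff₀ (by positivity)]
    nlinarith [sq_nonneg (|L' (dotp θ z) * dualNorm N θ| - 2 * c * n)]

theorem integral_mul_sq_dotp_le_of_isMin (hN : IsNormFun N) (hL : ConvexOn ℝ Set.univ L)
    (hLd : ∀ s, HasDerivAt L (L' s) s)
    (hint' : Integrable (fun z => (L' (dotp θ z)) ^ 2) μ) {ε lam : ℝ} (hε : 0 < ε)
    (hlam : 0 ≤ lam) (hfin : dualGain N L θ μ lam ≠ ⊤)
    (hmin : ∀ l, 0 ≤ l → ENNReal.ofReal (lam * ε) + dualGain N L θ μ lam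
      ≤ ENNReal.ofReal (l * ε) + dualGain N L θ μ l)
    {x : Fin d → ℝ} (hx : N x ≤ 1) :
    (∫ z, (L' (dotp θ z)) ^ 2 ∂μ) * dotp θ x ^ 2 ≤ 4 * ε * lam ^ 2 := by
  have hlow : ∀ l, 0 < l → lam ≤ l → (∫ z, (L' (dotp θ z)) ^ 2 ∂μ) * dotp θ x ^ 2
      ≤ 4 * l * (dualGain N L θ μ lam).toReal := fun l hl hle => by
    have := (le_dualGain hN hL hLd hint' hl hx).trans (antitone_dualGain hle)
    rw [ENNReal.ofReal_le_iff_le_toReal hfin, div_mul_eq_mul_div, div_le_iff₀ (by positivity)]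
      at this
    linarith
  rcases hlam.eq_or_lt with rfl | hpos
  · have := ge_of_tendsto (b := (∫ z, (L' (dotp θ z)) ^ 2 ∂μ) * dotp θ x ^ 2)
      (f := fun l : ℝ => 4 * l * (dualGain N L θ μ 0).toReal) (a := 0)
      (x := nhdsWithin 0 (Ioi 0)) ?_ ?_
    · simpa using this
    · have : Continuous fun l : ℝ => 4 * l * (dualGain N L θ μ 0).toReal := by fun_prop
      simpa using (this.tendsto 0).mono_left nhdsWithin_le_nhds
    · filter_upwards [self_mem_nhdsWithin] with l hl using hlow l hl (le_of_lt hl)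
  · have hr : ∀ r : ℝ, 1 < r → (dualGain N L θ μ lam).toReal ≤ r * (lam * ε) := fun r hr => by
      have hr0 : 0 < r := by linarith
      have h1 := mul_dualGain_mul_le (θ := θ) (μ := μ) hN hL hr.le lam
      have h2 := hmin (r * lam) (by positivity)
      have hf : dualGain N L θ μ (r * lam) ≠ ⊤ :=
        ne_top_of_le_ne_top hfin (antitone_dualGain (by nlinarith))
      have h1' := ENNReal.toReal_mono hfin h1
      have h2' := ENNReal.toReal_mono (by finiteness) h2
      rw [ENNReal.toReal_mul, ENNReal.toReal_ofReal hr0.le] at h1'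
      rw [ENNReal.toReal_add (by finiteness) hfin, ENNReal.toReal_add (by finiteness) hf,
        ENNReal.toReal_ofReal (by positivity), ENNReal.toReal_ofReal (by positivity)] at h2'
      have h3 := mul_le_mul_of_nonneg_left h2' hr0.le
      have h4 : (r - 1) * (dualGain N L θ μ lam).toReal ≤ (r - 1) * (r * (lam * ε)) := by
        linarith
      exact le_of_mul_le_mul_left h4 (by linarith)
    have hle : (dualGain N L θ μ lam).toReal ≤ lam * ε :=
      le_of_forall_gt_imp_ge_of_dense fun y hy => by
        have hp : 0 < lam * ε := by positivity
        have := hr (y / (lam * ε)) ((one_lt_div hp).2 hy)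
        rwa [div_mul_cancel₀ _ hp.ne'] at this
    have := hlow lam hpos le_rfl
    nlinarith

end DualGain

/-- **A priori bounds on the minimizers of the dual DRO problem.**
For a convex, upper semicontinuous, differentiable and `M`-smooth loss `L` with integrable
linear loss and squared derivative, the dual problem
`inf_{λ ≥ 0} λε + ∫ ℓ_c(θ, λ, ẑ) dP̂(ẑ)` admits a minimizer `λ*` with
`√(E‖θ‖_*²/(4ε)) ≤ λ* ≤ √(E‖θ‖_*²/ε) + M‖θ‖_*²/2`, where `E = ∫ |L'(⟨θ, ẑ⟩)|² dP̂`. -/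
theorem dual_minimizer_bounds {d : ℕ}
    (N : (Fin d → ℝ) → ℝ)
    (hN0 : ∀ x, N x = 0 ↔ x = 0)
    (hNhom : ∀ (a : ℝ) x, N (a • x) = |a| * N x)
    (hNtri : ∀ x y, N (x + y) ≤ N x + N y)
    (L L' : ℝ → ℝ)
    (hLconv : ConvexOn ℝ Set.univ L)
    (hLusc : UpperSemicontinuous L)
    (hLderiv : ∀ s, HasDerivAt L (L' s) s)
    (M : ℝ) (hM : ∀ s t : ℝ, |L' s - L' t| ≤ M * |s - t|)
    (Phat : ProbabilityMeasure (Fin d → ℝ))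
    (θ : Fin d → ℝ)
    (hint : Integrable (fun zhat => L (dotp θ zhat)) Phat.toMeasure)
    (hint' : Integrable (fun zhat => (L' (dotp θ zhat)) ^ 2) Phat.toMeasure)
    (ε : ℝ) (hε : 0 < ε) :
    ∃ lamstar : ℝ, 0 ≤ lamstar ∧
      (∀ lam : ℝ, 0 ≤ lam →
        ((lamstar * ε : ℝ) : EReal) +
            eint Phat.toMeasure (fun zhat => cTransform2 N L θ lamstar zhat) ≤
          ((lam * ε : ℝ) : EReal) +
            eint Phat.toMeasure (fun zhat => cTransform2 N L θ lam zhat)) ∧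
      Real.sqrt ((∫ zhat, (L' (dotp θ zhat)) ^ 2 ∂Phat.toMeasure) * dualNorm N θ ^ 2 /
        (4 * ε)) ≤ lamstar ∧
      lamstar ≤ Real.sqrt ((∫ zhat, (L' (dotp θ zhat)) ^ 2 ∂Phat.toMeasure) *
        dualNorm N θ ^ 2 / ε) + M * dualNorm N θ ^ 2 / 2 := by
  have hN : IsNormFun N := ⟨hN0, hNhom, hNtri⟩
  have hLc : Continuous L := continuous_iff_continuousAt.2 fun s => (hLderiv s).continuousAt
  have hM0 : 0 ≤ M := by simpa using (abs_nonneg _).trans (hM 1 0)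
  set μ := Phat.toMeasure
  set K := dualNorm N θ
  set E := ∫ zhat, (L' (dotp θ zhat)) ^ 2 ∂μ
  have hK0 : 0 ≤ K := hN.dualNorm_nonneg θ
  have hE0 : 0 ≤ E := integral_nonneg fun z => sq_nonneg _
  set c := Real.sqrt (E * K ^ 2 / (4 * ε)) with hcdef
  have hc0 : 0 ≤ c := Real.sqrt_nonneg _
  have hc : E * K ^ 2 = 4 * ε * c ^ 2 := by
    rw [hcdef, Real.sq_sqrt (by positivity)]
    field_simp
  have h2c : Real.sqrt (E * K ^ 2 / ε) = 2 * c := by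
    rw [hc, show 4 * ε * c ^ 2 / ε = (2 * c) ^ 2 by field_simp; ring]
    exact Real.sqrt_sq (by positivity)
  rw [h2c]
  set B := 2 * c + M * K ^ 2 / 2 with hB
  have hobj : ∀ lam : ℝ, 0 ≤ lam → ((lam * ε : ℝ) : EReal) +
      eint μ (fun zhat => cTransform2 N L θ lam zhat) = ((∫ z, L (dotp θ z) ∂μ : ℝ) : EReal) +
        ((ENNReal.ofReal (lam * ε) + dualGain N L θ μ lam : ENNReal) : EReal) := by
    intro lam hlam
    simp only [cTransform2_eq hN]
    rw [eint_add_coe hint (hLc.comp (continuous_dotp θ)).measurable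
      (measurable_gain_dotp hLc lam), EReal.coe_ennreal_add,
      EReal.coe_ennreal_ofReal, max_eq_left (by positivity), add_left_comm, dualGain]
  obtain ⟨lam, hlamB, hlam⟩ := LowerSemicontinuousOn.exists_isMinOn
    (f := fun l => ENNReal.ofReal (l * ε) + dualGain N L θ μ l) (s := Icc 0 B)
    (nonempty_Icc.2 (by positivity)) isCompact_Icc
    (((ENNReal.continuous_ofReal.comp (continuous_mul_const ε)).lowerSemicontinuous.add
      (lowerSemicontinuous_dualGain hLc)).lowerSemicontinuousOn _)
  have hbound : ENNReal.ofReal (lam * ε) + dualGain N L θ μ lam ≤ ENNReal.ofReal (B * ε) := by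
    refine (hlam (show M * K ^ 2 / 2 + c ∈ Icc 0 B from
      ⟨by positivity, by linarith⟩)).trans ?_
    refine (add_le_add_right (dualGain_le hN hLderiv hM hint' hc0 hc) _).trans ?_
    rw [← ENNReal.ofReal_add (by positivity) (by positivity)]
    exact ENNReal.ofReal_le_ofReal (le_of_eq (by rw [hB]; ring))
  have hmin : ∀ l, 0 ≤ l → ENNReal.ofReal (lam * ε) + dualGain N L θ μ lam
      ≤ ENNReal.ofReal (l * ε) + dualGain N L θ μ l := by
    intro l hl
    rcases le_or_gt l B with h | h
    · exact hlam ⟨hl, h⟩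
    · exact hbound.trans ((ENNReal.ofReal_le_ofReal
        (mul_le_mul_of_nonneg_right h.le hε.le)).trans le_self_add)
  have hfin : dualGain N L θ μ lam ≠ ⊤ :=
    ne_top_of_le_ne_top ENNReal.ofReal_ne_top (le_add_self.trans hbound)
  refine ⟨lam, hlamB.1, fun l hl => ?_, ?_, hlamB.2⟩
  · rw [hobj lam hlamB.1, hobj l hl]
    exact add_le_add_right (EReal.coe_ennreal_le_coe_ennreal_iff.2 (hmin l hl)) _
  · have hEK : E * K ^ 2 ≤ 4 * ε * lam ^ 2 := by
      rcases hE0.eq_or_lt with h | h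
      · rw [← h, zero_mul]
        positivity
      · have hKle : K ≤ Real.sqrt (4 * ε * lam ^ 2 / E) := hN.dualNorm_le θ fun x hx =>
          Real.le_sqrt_of_sq_le <| by
            rw [le_div_iff₀ h, mul_comm]
            exact integral_mul_sq_dotp_le_of_isMin hN hLconv hLderiv hint' hε hlamB.1 hfin hmin hx
        rw [Real.le_sqrt hK0 (by positivity), le_div_iff₀ h] at hKle
        linarith
    refine Real.sqrt_le_iff.2 ⟨hlamB.1, ?_⟩
    rw [div_le_iff₀ (by positivity)]
    linarith
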